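/- There exists a representable operator T₀ on L₁[0,1] which is not compact, such that S∘T₀ is compact for every representable operator S on L₁[0,1]. Consequently, the ideal 𝔯 of representable operators on L₁[0,1] does not have any left approximate identity, bounded or otherwise. -/

import Mathlib

open scoped TensorProduct ENNReal
open MeasureTheory Filter

noncomputable section

/-- Lebesgue measure on `ℝ` restricted to the unit interval `[0,1]`. -/
def μ01 : Measure ℝ := volume.restrict (Set.Icc 0 1)

/-- The complex Lebesgue space `L₁[0,1]`. -/
abbrev L1C : Type := Lp ℂ 1 μ01

/-- An operator `T : L₁[0,1] → E` is representable if there is a bounded, strongly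
measurable `h : [0,1] → E` such that `T f = ∫₀¹ f(s) • h(s) ds` (a Bochner integral). -/
def IsRepresentable {E : Type*} [NormedAddCommGroup E] [NormedSpace ℂ E]
    (T : L1C →L[ℂ] E) : Prop :=
  ∃ h : ℝ → E, StronglyMeasurable h ∧ (∃ C : ℝ, ∀ t ∈ Set.Icc (0:ℝ) 1, ‖h t‖ ≤ C) ∧
    ∀ f : L1C, T f = ∫ s, (f : ℝ → ℂ) s • h s ∂μ01

/-- An operator between normed spaces is compact if it maps the closed unit ball to a
totally bounded set. -/
def CompactOp {E F : Type*} [NormedAddCommGroup E] [NormedSpace ℂ E]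
    [NormedAddCommGroup F] [NormedSpace ℂ F] (T : E →L[ℂ] F) : Prop :=
  TotallyBounded (Set.image (⇑T) (Metric.closedBall (0 : E) 1))

/-- An operator between normed spaces is weakly compact if the image of the closed unit ball
is relatively compact in the weak topology. -/
def WeaklyCompactOp {E F : Type*} [NormedAddCommGroup E] [NormedSpace ℂ E]
    [NormedAddCommGroup F] [NormedSpace ℂ F] (T : E →L[ℂ] F) : Prop :=
  IsCompact (closure (Set.image (⇑(toWeakSpace ℂ F)) (Set.image (⇑T) (Metric.closedBall (0 : E) 1))))

instance : IsFiniteMeasure μ01 := by unfold μ01; infer_instance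

/-- A set which is approximated up to every `ε` by totally bounded sets is totally bounded. -/
lemma totallyBounded_of_forall_approx {E : Type*} [PseudoMetricSpace E] {s : Set E}
    (H : ∀ ε : ℝ, 0 < ε → ∃ t : Set E, TotallyBounded t ∧ ∀ x ∈ s, ∃ y ∈ t, dist x y ≤ ε) :
    TotallyBounded s := by
  rw [Metric.totallyBounded_iff]
  intro ε hε
  obtain ⟨t, ht, hst⟩ := H (ε / 2) (half_pos hε)
  obtain ⟨u, hu, htu⟩ := Metric.totallyBounded_iff.1 ht (ε / 2) (half_pos hε)
  refine ⟨u, hu, fun x hx => ?_⟩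
  obtain ⟨y, hy, hxy⟩ := hst x hx
  obtain ⟨z, hz, hyz⟩ := Set.mem_iUnion₂.1 (htu hy)
  refine Set.mem_iUnion₂.2 ⟨z, hz, ?_⟩
  rw [Metric.mem_ball] at hyz ⊢
  linarith [dist_triangle x y z]

/-- A totally bounded set contains no sequence whose terms are pairwise at distance at
least `1`. -/
lemma not_totallyBounded_of_separated {E : Type*} [PseudoMetricSpace E] {s : Set E} {g : ℕ → E}
    (hg : ∀ n, g n ∈ s) (hsep : Pairwise fun n m => 1 ≤ dist (g n) (g m)) : ¬ TotallyBounded s := by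
  intro hs
  obtain ⟨t, ht, hst⟩ := Metric.totallyBounded_iff.1 hs (1 / 2) (by norm_num)
  have : ∀ n, ∃ y : t, dist (g n) y < 1 / 2 := fun n => by
    obtain ⟨y, hy, hy'⟩ := Set.mem_iUnion₂.1 (hst (hg n))
    exact ⟨⟨y, hy⟩, hy'⟩
  choose F hF using this
  have := ht.to_subtype
  obtain ⟨n, m, hnm, hFnm⟩ := Finite.exists_ne_map_eq_of_infinite F
  have h1 := hF n
  have h2 := hF m
  rw [← hFnm] at h2
  linarith [hsep hnm, dist_triangle_right (g n) (g m) (F n)]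

section General

variable {E : Type*} [NormedAddCommGroup E] [NormedSpace ℂ E]

lemma integrable_smul_of_bounded (f : L1C) {h : ℝ → E} (hh : StronglyMeasurable h) {C : ℝ}
    (hC : ∀ t, ‖h t‖ ≤ C) : Integrable (fun s => (f : ℝ → ℂ) s • h s) μ01 :=
  (L1.integrable_coeFn f).smul_bdd C hh.aestronglyMeasurable (.of_forall hC)

lemma norm_integral_smul_le (f : L1C) {h : ℝ → E} {C : ℝ} (hC : ∀ t, ‖h t‖ ≤ C) :
    ‖∫ s, (f : ℝ → ℂ) s • h s ∂μ01‖ ≤ C * ‖f‖ := by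
  rw [L1.norm_eq_integral_norm, ← integral_const_mul]
  refine norm_integral_le_of_norm_le ((L1.integrable_coeFn f).norm.const_mul C)
    (.of_forall fun s => ?_)
  rw [norm_smul, mul_comm]
  exact mul_le_mul_of_nonneg_right (hC s) (norm_nonneg _)

/-- Every bounded strongly measurable function is the kernel of a bounded operator. -/
lemma exists_operator_of_kernel {h : ℝ → E} (hh : StronglyMeasurable h) {C : ℝ}
    (hC : ∀ t, ‖h t‖ ≤ C) :
    ∃ T : L1C →L[ℂ] E, ∀ f : L1C, T f = ∫ s, (f : ℝ → ℂ) s • h s ∂μ01 := by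
  refine ⟨LinearMap.mkContinuous
    { toFun := fun f => ∫ s, (f : ℝ → ℂ) s • h s ∂μ01
      map_add' := fun f g => ?_
      map_smul' := fun c f => ?_ } C fun f => norm_integral_smul_le f hC, fun f => rfl⟩
  · rw [← integral_add (integrable_smul_of_bounded f hh hC) (integrable_smul_of_bounded g hh hC)]
    refine integral_congr_ae ?_
    filter_upwards [Lp.coeFn_add f g] with s hs
    rw [hs, Pi.add_apply, add_smul]
  · rw [RingHom.id_apply, ← integral_smul]
    refine integral_congr_ae ?_
    filter_upwards [Lp.coeFn_smul c f] with s hs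
    rw [hs, Pi.smul_apply, smul_assoc]

/-- An operator whose kernel takes countably many values, tending to zero, is compact. -/
lemma compactOp_of_kernel_tendsto_zero [CompleteSpace E] {N : ℝ → ℕ} (hN : Measurable N) {v : ℕ → E}
    (hv : Tendsto v atTop (nhds 0)) {T : L1C →L[ℂ] E}
    (hT : ∀ f : L1C, T f = ∫ s, (f : ℝ → ℂ) s • v (N s) ∂μ01) : CompactOp T := by
  refine totallyBounded_of_forall_approx fun ε hε => ?_
  obtain ⟨M, hM⟩ := Metric.tendsto_atTop.1 hv ε hε
  let Φ : (Fin M → ℂ) →ₗ[ℂ] E := Fintype.linearCombination ℂ fun i : Fin M => v i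
  have hΦ : Continuous Φ := Φ.continuous_of_finiteDimensional
  refine ⟨Φ '' Metric.closedBall 0 1,
    ((isCompact_closedBall _ _).image hΦ).totallyBounded, ?_⟩
  rintro _ ⟨f, hf, rfl⟩
  have hf1 : ‖f‖ ≤ 1 := by simpa using hf
  have hset : ∀ i, MeasurableSet (N ⁻¹' {i}) := fun i => hN (measurableSet_singleton i)
  have hfi := L1.integrable_coeFn f
  refine ⟨_, ⟨fun i => ∫ s in N ⁻¹' {(i : ℕ)}, (f : ℝ → ℂ) s ∂μ01, ?_, rfl⟩, ?_⟩
  · rw [mem_closedBall_zero_iff, pi_norm_le_iff_of_nonneg zero_le_one]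
    intro i
    refine (norm_integral_le_integral_norm _).trans ?_
    refine (setIntegral_le_integral hfi.norm (.of_forall fun _ => norm_nonneg _)).trans ?_
    rwa [← L1.norm_eq_integral_norm]
  · obtain ⟨C, hC⟩ : ∃ C, ∀ n, ‖v n‖ ≤ C := by
      obtain ⟨C, hC⟩ := hv.norm.bddAbove_range
      exact ⟨C, fun n => hC ⟨n, rfl⟩⟩
    have hsm : StronglyMeasurable fun s => v (N s) :=
      (StronglyMeasurable.of_discrete (f := v)).comp_measurable hN
    have key : Φ (fun i => ∫ s in N ⁻¹' {(i : ℕ)}, (f : ℝ → ℂ) s ∂μ01)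
        = ∫ s, (f : ℝ → ℂ) s • (if N s < M then v (N s) else 0) ∂μ01 := by
      rw [Fintype.linearCombination_apply]
      have : ∀ i : Fin M, (∫ s in N ⁻¹' {(i : ℕ)}, (f : ℝ → ℂ) s ∂μ01) • v i
          = ∫ s, (N ⁻¹' {(i : ℕ)}).indicator (f : ℝ → ℂ) s • v i ∂μ01 := fun i => by
        rw [integral_smul_const, integral_indicator (hset i)]
      simp_rw [this]
      rw [← integral_finsetSum Finset.univ fun (i : Fin M) _ => (hfi.indicator (hset i)).smul_const (v i)]
      congr 1
      ext s
      split_ifs with h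
      · rw [Finset.sum_eq_single (⟨N s, h⟩ : Fin M)]
        · simp
        · intro i _ hi
          rw [Set.indicator_of_notMem, zero_smul]
          intro hs
          exact hi (Fin.ext (by simpa using Eq.symm hs))
        · simp
      · rw [smul_zero]
        refine Finset.sum_eq_zero fun i _ => ?_
        rw [Set.indicator_of_notMem, zero_smul]
        intro hs
        have : N s = i := hs
        exact h (this ▸ i.2)
    have hite : StronglyMeasurable fun s => if N s < M then v (N s) else 0 :=
      (StronglyMeasurable.of_discrete (f := fun n => if n < M then v n else 0)).comp_measurable hN
    have hC0 : 0 ≤ C := (norm_nonneg _).trans (hC 0)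
    rw [dist_eq_norm, hT, key, ← integral_sub
      (integrable_smul_of_bounded f hsm fun s => hC (N s))
      (integrable_smul_of_bounded f hite (C := C) fun s => by
        split_ifs
        · exact hC _
        · simpa using hC0)]
    simp_rw [← smul_sub]
    refine (norm_integral_smul_le f (C := ε) fun s => ?_).trans
      (mul_le_of_le_one_right hε.le hf1)
    split_ifs with h
    · simpa using hε.le
    · simpa using (hM _ (not_lt.1 h)).le

end General

/-- The character `t ↦ exp (-2πint)` as an element of `L₁[0,1]`. -/
def expL1 (n : ℕ) : L1C :=
  MemLp.toLp (fun t : ℝ => ((Real.fourierChar (-(t * n)) : Circle) : ℂ))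
    (MemLp.of_bound (by fun_prop) 1 (.of_forall fun t => (Circle.norm_coe _).le))

lemma coeFn_expL1 (n : ℕ) :
    (expL1 n : ℝ → ℂ) =ᵐ[μ01] fun t => ((Real.fourierChar (-(t * n)) : Circle) : ℂ) :=
  MemLp.coeFn_toLp _

lemma norm_expL1_le (n : ℕ) : ‖expL1 n‖ ≤ 1 := by
  rw [L1.norm_eq_integral_norm, integral_congr_ae (g := fun _ => (1 : ℝ))]
  · simp [μ01, Measure.real]
  · filter_upwards [coeFn_expL1 n] with t ht
    rw [ht, Circle.norm_coe]

lemma integral_exp_int_period {k : ℤ} (hk : k ≠ 0) :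
    ∫ t, Complex.exp (2 * Real.pi * k * Complex.I * (t : ℝ)) ∂μ01 = 0 := by
  have hc : (2 * Real.pi * k * Complex.I : ℂ) ≠ 0 := by
    simp [hk, Real.pi_ne_zero]
  rw [μ01, integral_Icc_eq_integral_Ioc, ← intervalIntegral.integral_of_le zero_le_one,
    integral_exp_mul_complex hc]
  have : Complex.exp (2 * Real.pi * k * Complex.I * (1 : ℝ)) = 1 := by
    rw [← Complex.exp_int_mul_two_pi_mul_I k]
    congr 1
    push_cast
    ring
  rw [this]
  simp

lemma one_le_dist_expL1 {n m : ℕ} (hnm : n ≠ m) : 1 ≤ dist (expL1 n) (expL1 m) := by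
  have hk : ((n : ℤ) - m) ≠ 0 := sub_ne_zero.2 (by exact_mod_cast hnm)
  have hint : Integrable
      (fun t : ℝ => Complex.exp (2 * Real.pi * ((n : ℤ) - m : ℤ) * Complex.I * t)) μ01 :=
    (Continuous.integrableOn_Icc (by fun_prop))
  have h1 : ∫ t, (1 - Complex.exp (2 * Real.pi * ((n : ℤ) - m : ℤ) * Complex.I * (t : ℝ))) ∂μ01
      = 1 := by
    rw [integral_sub (integrable_const _) hint, integral_exp_int_period hk]
    simp [μ01, Measure.real]
  rw [dist_eq_norm, L1.norm_eq_integral_norm]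
  calc (1 : ℝ) = ‖∫ t, (1 - Complex.exp (2 * Real.pi * ((n : ℤ) - m : ℤ) * Complex.I * (t : ℝ)))
        ∂μ01‖ := by rw [h1, norm_one]
    _ ≤ _ := norm_integral_le_of_norm_le (L1.integrable_coeFn _).norm ?_
  filter_upwards [Lp.coeFn_sub (expL1 n) (expL1 m), coeFn_expL1 n, coeFn_expL1 m]
    with t ht hn hm
  rw [ht, Pi.sub_apply, hn, hm]
  have : (1 - Complex.exp (2 * Real.pi * ((n : ℤ) - m : ℤ) * Complex.I * (t : ℝ)))
      * ((Real.fourierChar (-(t * n)) : Circle) : ℂ)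
      = ((Real.fourierChar (-(t * n)) : Circle) : ℂ)
        - ((Real.fourierChar (-(t * m)) : Circle) : ℂ) := by
    rw [sub_mul, one_mul, Real.fourierChar_apply, Real.fourierChar_apply, ← Complex.exp_add]
    congr 2
    push_cast
    ring
  rw [← this, norm_mul, Circle.norm_coe, mul_one]

/-- A representable operator maps the characters to a null sequence (Riemann–Lebesgue). -/
lemma IsRepresentable.tendsto_expL1 {E : Type*} [NormedAddCommGroup E] [NormedSpace ℂ E]
    {S : L1C →L[ℂ] E} (hS : IsRepresentable S) :
    Tendsto (fun n => S (expL1 n)) atTop (nhds 0) := by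
  obtain ⟨h, -, -, hSh⟩ := hS
  have hRL := Real.tendsto_integral_exp_smul_cocompact ((Set.Icc (0 : ℝ) 1).indicator h)
  have hco : Tendsto (fun n : ℕ => (n : ℝ)) atTop (cocompact ℝ) :=
    tendsto_natCast_atTop_atTop.mono_right atTop_le_cocompact
  refine (hRL.comp hco).congr fun n => ?_
  rw [hSh, Function.comp_apply,
    integral_congr_ae ((coeFn_expL1 n).mono fun t ht => congrArg (· • h t) ht), μ01,
    ← integral_indicator measurableSet_Icc]
  congr 1
  ext t
  by_cases ht : t ∈ Set.Icc (0 : ℝ) 1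
  · simp [ht, Circle.smul_def]
  · simp [ht]

/-- The index of the interval `(1/(n+1), 1/n]` containing a point of `(0,1]`. -/
def invFloor (s : ℝ) : ℕ := ⌊s⁻¹⌋₊

lemma measurable_invFloor : Measurable invFloor := Nat.measurable_floor.comp measurable_inv

lemma measure_invFloor_pos (n : ℕ) : 0 < μ01 (invFloor ⁻¹' {n + 1}) := by
  have h0 : (0 : ℝ) < n + 1 := by positivity
  have hsub : Set.Ioo ((n + 2 : ℝ)⁻¹) ((n + 1 : ℝ)⁻¹)
      ⊆ invFloor ⁻¹' {n + 1} ∩ Set.Icc 0 1 := by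
    rintro s ⟨h1, h2⟩
    have hs : 0 < s := lt_trans (by positivity) h1
    refine ⟨?_, hs.le, h2.le.trans (inv_le_one_of_one_le₀ (by linarith))⟩
    rw [Set.mem_preimage, Set.mem_singleton_iff, invFloor,
      Nat.floor_eq_iff (inv_nonneg.2 hs.le)]
    push_cast
    constructor
    · exact (le_inv_comm₀ h0 hs).2 h2.le
    · have := (inv_lt_comm₀ (by positivity) hs).1 h1
      linarith
  rw [μ01, Measure.restrict_apply (measurable_invFloor (measurableSet_singleton _))]
  refine lt_of_lt_of_le ?_ (measure_mono hsub)
  rw [Real.volume_Ioo, ENNReal.ofReal_pos, sub_pos]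
  exact inv_strictAnti₀ h0 (by linarith)

/-- The operator with kernel `s ↦ g ⌊1/s⌋` maps some point of the unit ball to `g (n + 1)`. -/
lemma mem_image_of_kernel_invFloor {E : Type*} [NormedAddCommGroup E] [NormedSpace ℂ E]
    [CompleteSpace E] {T : L1C →L[ℂ] E} {g : ℕ → E}
    (hT : ∀ f : L1C, T f = ∫ s, (f : ℝ → ℂ) s • g (invFloor s) ∂μ01) (n : ℕ) :
    g (n + 1) ∈ T '' Metric.closedBall 0 1 := by
  have hA : MeasurableSet (invFloor ⁻¹' {n + 1}) :=
    measurable_invFloor (measurableSet_singleton _)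
  have hμ : μ01.real (invFloor ⁻¹' {n + 1}) ≠ 0 :=
    (ENNReal.toReal_pos (measure_invFloor_pos n).ne' (measure_ne_top _ _)).ne'
  refine ⟨indicatorConstLp 1 hA (measure_ne_top _ _)
    ((μ01.real (invFloor ⁻¹' {n + 1}) : ℂ)⁻¹), ?_, ?_⟩
  · rw [mem_closedBall_zero_iff, norm_indicatorConstLp one_ne_zero ENNReal.one_ne_top]
    simp [abs_of_nonneg measureReal_nonneg, inv_mul_cancel₀ hμ]
  · rw [hT, integral_congr_ae (g := (invFloor ⁻¹' {n + 1}).indicator fun _ =>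
      (μ01.real (invFloor ⁻¹' {n + 1}) : ℂ)⁻¹ • g (n + 1))]
    · rw [integral_indicator hA, setIntegral_const, ← Complex.coe_smul, smul_smul,
        mul_inv_cancel₀ (by exact_mod_cast hμ), one_smul]
    · filter_upwards [indicatorConstLp_coeFn (p := 1) (hs := hA) (hμs := measure_ne_top μ01 _)
        (c := (μ01.real (invFloor ⁻¹' {n + 1}) : ℂ)⁻¹)] with s hs
      rw [hs]
      by_cases h : s ∈ invFloor ⁻¹' {n + 1}
      · have h' : invFloor s = n + 1 := h
        rw [Set.indicator_of_mem h, Set.indicator_of_mem h, h']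
      · rw [Set.indicator_of_notMem h, Set.indicator_of_notMem h, zero_smul]

/-- There is a representable, non-compact operator `T₀` on `L₁[0,1]` such that `S ∘ T₀` is
compact for every representable `S`; consequently the ideal `𝔯` of representable operators
has no left approximate identity (bounded or otherwise). -/
theorem exists_representable_noncompact_killing_and_no_lai :
    (∃ T₀ : L1C →L[ℂ] L1C, IsRepresentable T₀ ∧ ¬ CompactOp T₀ ∧
      ∀ S : L1C →L[ℂ] L1C, IsRepresentable S → CompactOp (S.comp T₀)) ∧
    ¬ (∀ (F : Finset (L1C →L[ℂ] L1C)), (∀ T ∈ F, IsRepresentable T) →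
        ∀ ε : ℝ, 0 < ε → ∃ e : L1C →L[ℂ] L1C, IsRepresentable e ∧
          ∀ T ∈ F, ‖T - e.comp T‖ < ε) := by
  have hsm : StronglyMeasurable fun s => expL1 (invFloor s) :=
    (StronglyMeasurable.of_discrete (f := expL1)).comp_measurable measurable_invFloor
  have hbd : ∀ s, ‖expL1 (invFloor s)‖ ≤ 1 := fun s => norm_expL1_le _
  obtain ⟨T₀, hT₀⟩ := exists_operator_of_kernel hsm hbd
  have hrep : IsRepresentable T₀ := ⟨_, hsm, ⟨1, fun t _ => hbd t⟩, hT₀⟩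
  have hnc : ¬ CompactOp T₀ :=
    not_totallyBounded_of_separated (mem_image_of_kernel_invFloor hT₀) fun n m hnm =>
      one_le_dist_expL1 (by simpa using hnm)
  have hcomp : ∀ S : L1C →L[ℂ] L1C, IsRepresentable S → CompactOp (S.comp T₀) := by
    intro S hS
    refine compactOp_of_kernel_tendsto_zero measurable_invFloor hS.tendsto_expL1 fun f => ?_
    rw [ContinuousLinearMap.comp_apply, hT₀]
    simp_rw [← map_smul]
    exact (S.integral_comp_comm (integrable_smul_of_bounded f hsm hbd)).symm
  refine ⟨⟨T₀, hrep, hnc, hcomp⟩, fun H => hnc ?_⟩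
  refine totallyBounded_of_forall_approx fun ε hε => ?_
  obtain ⟨e, he, hle⟩ := H {T₀} (by simpa using hrep) ε hε
  refine ⟨_, hcomp e he, ?_⟩
  rintro _ ⟨f, hf, rfl⟩
  refine ⟨_, ⟨f, hf, rfl⟩, ?_⟩
  rw [dist_eq_norm, ← sub_apply]
  exact (ContinuousLinearMap.le_of_opNorm_le_of_le _ (hle T₀ (by simp)).le
    (mem_closedBall_zero_iff.1 hf)).trans_eq (mul_one ε)
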